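/- Fix an integer r ≥ 2. Let U_r be the quotient of U by the subspace spanned by all the elements Σ_{i≥1} u_{α+jrε_i}, for α ∈ M and j ≥ 1 (all but finitely many terms of each such sum vanish in U). Then the assignment u_α ↦ S^(r)_α(t) induces a well-defined ℚ-linear isomorphism U_r → P^(r). -/

import Mathlib

open scoped BigOperators Classical

namespace RSF

/-! ### Partitions -/

/-- A partition, encoded as its (0-indexed, weakly decreasing, eventually zero)
sequence of parts: `f (j-1) = λ_j`. -/
def IsPartition (f : ℕ → ℕ) : Prop :=
  (∀ i j : ℕ, i ≤ j → f j ≤ f i) ∧ ∃ N : ℕ, ∀ i : ℕ, N ≤ i → f i = 0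

/-- The size `|λ|` of a partition. -/
noncomputable def psize (f : ℕ → ℕ) : ℕ := ∑ᶠ i, f i

/-- The number of (nonzero) parts of a partition. -/
noncomputable def plen (f : ℕ → ℕ) : ℕ := sInf {N : ℕ | ∀ i : ℕ, N ≤ i → f i = 0}

/-- The empty partition. -/
def emptyPart : ℕ → ℕ := fun _ => 0

/-- The transpose (conjugate) partition: `λ'_i = #{j : λ_j ≥ i}` (0-indexed). -/
noncomputable def transposeP (f : ℕ → ℕ) : ℕ → ℕ := fun i => Nat.card {j : ℕ // i < f j}

/-! ### Symmetric functions, Schur functions, Littlewood-Richardson coefficients -/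

/-- The ring of symmetric functions `Λ = ℚ[p_1, p_2, …]`; the variable `m` stands for the
power sum `p_{m+1}`. -/
abbrev SymmAlg : Type := MvPolynomial ℕ ℚ

/-- The power sum `p_j ∈ Λ` (for `j ≥ 1`). -/
noncomputable def pwr (j : ℕ) : SymmAlg := MvPolynomial.X (j - 1)

/-- Evaluation `ev_n : Λ → ℚ[x_1,…,x_n]`, sending `p_j` to `x_1^j + ⋯ + x_n^j`. -/
noncomputable def ev (n : ℕ) : SymmAlg →ₐ[ℚ] MvPolynomial (Fin n) ℚ :=
  MvPolynomial.aeval fun j => ∑ i : Fin n, MvPolynomial.X i ^ (j + 1)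

/-- The matrix `(x_i^{λ_j + n - j})_{1 ≤ i,j ≤ n}` (0-indexed). -/
noncomputable def schurMat (f : ℕ → ℕ) (n : ℕ) :
    Matrix (Fin n) (Fin n) (MvPolynomial (Fin n) ℚ) :=
  Matrix.of fun i j => MvPolynomial.X i ^ (f (j : ℕ) + (n - 1 - (j : ℕ)))

/-- `S` is the family of Schur functions: for every partition `λ` and every `n` at least the
number of parts of `λ`, `ev_n (S_λ) = det(x_i^{λ_j+n-j}) / det(x_i^{n-j})`.
(This determines `S_λ` uniquely.) -/
def IsSchurFamily (S : (ℕ → ℕ) → SymmAlg) : Prop :=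
  ∀ f : ℕ → ℕ, IsPartition f → ∀ n : ℕ, plen f ≤ n →
    ev n (S f) * (schurMat emptyPart n).det = (schurMat f n).det

/-- `LR` is the family of (multi-factor) Littlewood–Richardson coefficients of the Schur
family `S`: `S_{μ_1} ⋯ S_{μ_m} = Σ_λ LR^λ_{μ_1⋯μ_m} S_λ`. -/
def IsLRFamily (S : (ℕ → ℕ) → SymmAlg) (LR : (ℕ → ℕ) → List (ℕ → ℕ) → ℚ) : Prop :=
  (∀ lam L, ¬ IsPartition lam → LR lam L = 0) ∧
  (∀ lam L, LR lam L ≠ 0 → psize lam = (L.map psize).sum) ∧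
  (∀ L : List (ℕ → ℕ), (∀ g ∈ L, IsPartition g) →
    (L.map S).prod = ∑ᶠ lam : ℕ → ℕ, LR lam L • S lam)

/-- The ring `P^(r) = ℚ[t_j : j ≥ 1, r ∤ j]`. -/
abbrev PR (r : ℕ) : Type := MvPolynomial {j : ℕ // 0 < j ∧ ¬ r ∣ j} ℚ

/-- The homomorphism `ρ^(r) : Λ → P^(r)`, `p_j ↦ j·t_j` if `r ∤ j`, `p_j ↦ 0` if `r ∣ j`. -/
noncomputable def rho (r : ℕ) : SymmAlg →ₐ[ℚ] PR r :=
  MvPolynomial.aeval fun m =>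
    if h : r ∣ (m + 1) then 0
    else ((m + 1 : ℕ) : ℚ) • MvPolynomial.X ⟨m + 1, Nat.succ_pos m, h⟩

/-! ### Beta-sets, cores, quotients, and the `r`-sign -/

/-- The beta-set `{λ_i + N - i : 1 ≤ i ≤ N}` of a partition (first-`N` beta numbers);
it is the set of nonnegative entries of the representative of the corresponding Maya
diagram whose negative entries are exactly `{-1, -2, -3, …}` and which has `N`
nonnegative entries. -/
def betaFinset (f : ℕ → ℕ) (N : ℕ) : Finset ℕ :=
  (Finset.range N).image fun i => f i + (N - 1 - i)

/-- The elements of a finite set of naturals, listed in decreasing order. -/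
def descSort (s : Finset ℕ) : List ℕ := (s.sort (· ≤ ·)).reverse

/-- The partition whose beta-set (with `s.card` beta numbers) is `s`:
`λ_j = b_j - (card - j)` where `b_1 > b_2 > ⋯` are the elements of `s`. -/
def partOfBeta (s : Finset ℕ) : ℕ → ℕ :=
  fun j => (descSort s).getD j 0 - (s.card - 1 - j)

/-- A canonical choice of `N`: a multiple of `r` which is at least the number of parts.
(The constructions below are independent of this choice.) -/
noncomputable def defaultN (r : ℕ) (f : ℕ → ℕ) : ℕ := r * (plen f + 1)

/-- The `k`-th component `λ[k]` of the `r`-quotient of a partition. -/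
noncomputable def quotP (r : ℕ) (f : ℕ → ℕ) (k : ℕ) : ℕ → ℕ :=
  partOfBeta (((betaFinset f (defaultN r f)).filter fun b => b % r = k).image
    fun b => (b - k) / r)

/-- The `r`-core `λ_c` of a partition. -/
noncomputable def coreP (r : ℕ) (f : ℕ → ℕ) : ℕ → ℕ :=
  partOfBeta ((Finset.range r).biUnion fun k =>
    (Finset.range (((betaFinset f (defaultN r f)).filter fun b => b % r = k).card)).image
      fun j => j * r + k)

/-- The interleaved reading of the nonnegative entries: for `j = 1, 2, …` and
`k = 0, …, r-1`, the `j`-th largest beta number congruent to `k` mod `r` (if it exists). -/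
def interleaveAt (r N : ℕ) (f : ℕ → ℕ) : List ℕ :=
  (List.range N).flatMap fun j =>
    (List.range r).filterMap fun k =>
      (descSort ((betaFinset f N).filter fun b => b % r = k))[j]?

/-- The number of inversions of a list of naturals with respect to decreasing order. -/
def invCount (L : List ℕ) : ℕ :=
  ((Finset.range L.length ×ˢ Finset.range L.length).filter fun pq =>
    pq.1 < pq.2 ∧ L.getD pq.1 0 < L.getD pq.2 0).card

/-- The sign of the permutation sorting the interleaved reading of the nonnegative
entries of the chosen representative into decreasing order. -/
def deltaSignAt (r N : ℕ) (f : ℕ → ℕ) : ℤ := (-1) ^ invCount (interleaveAt r N f)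

/-- The `r`-sign `δ_r(λ)`: the sign of the permutation sorting the interleaved reading of
the nonnegative entries into decreasing order.  (It is normalized relative to the `r`-core,
so as to be independent of the choice of representative; on `r`-cores it is `+1`.) -/
noncomputable def deltaSign (r : ℕ) (f : ℕ → ℕ) : ℤ :=
  deltaSignAt r (defaultN r f) f * deltaSignAt r (defaultN r f) (coreP r f)

/-! ### Generalized Maya diagrams -/

/-- A generalized Maya diagram (as a sequence): `α_{i+1} = α_i - 1` for all large `i`. -/
def IsMaya (a : ℕ → ℤ) : Prop := ∃ N : ℕ, ∀ i : ℕ, N ≤ i → a (i + 1) = a i - 1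

/-- A strictly decreasing sequence (member of `M_d`). -/
def StrictDec (a : ℕ → ℤ) : Prop := ∀ i j : ℕ, i < j → a j < a i

/-- The action of `S_n ⊆ S_∞` on sequences, permuting the first `n` entries. -/
def permAct {n : ℕ} (σ : Equiv.Perm (Fin n)) (a : ℕ → ℤ) : ℕ → ℤ :=
  fun i => if h : i < n then a ((σ⁻¹ ⟨i, h⟩ : Fin n) : ℕ) else a i

/-- `f = λ(a)` : the partition associated with a strictly decreasing Maya sequence,
`λ_j = a_j - a_n + (j - n)` for all sufficiently large `n`. -/
def MayaCorresponds (a : ℕ → ℤ) (f : ℕ → ℕ) : Prop :=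
  ∃ N : ℕ, ∀ n : ℕ, N ≤ n → ∀ j : ℕ, j ≤ n →
    (f j : ℤ) = a j - a n + (j : ℤ) - (n : ℤ)

/-- `α + c·ε_i` : increase the `i`-th entry by `c`. -/
def addAt (a : ℕ → ℤ) (i : ℕ) (c : ℤ) : ℕ → ℤ := Function.update a i (a i + c)

/-- `SM` extends the Schur family `S` to generalized Maya diagrams:
`S_α = sgn(σ)·S_{λ(σα)}` when `σα` is strictly decreasing, and `S_α = 0` when `α` has
two equal entries. -/
def IsMayaSchur (S : (ℕ → ℕ) → SymmAlg) (SM : (ℕ → ℤ) → SymmAlg) : Prop :=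
  (∀ a : ℕ → ℤ, IsMaya a → (∃ i j : ℕ, i ≠ j ∧ a i = a j) → SM a = 0) ∧
  (∀ a : ℕ → ℤ, IsMaya a → ∀ (n : ℕ) (σ : Equiv.Perm (Fin n)) (f : ℕ → ℕ),
    StrictDec (permAct σ a) → MayaCorresponds (permAct σ a) f →
    SM a = ((Equiv.Perm.sign σ : ℤ) : ℚ) • S f)

/-- The `k`-th piece `α[k]` of the `r`-quotient of a Maya sequence (in its canonical
representative): the subsequence of entries congruent to `k` mod `r`, with
`α^{(k)}_i ↦ (α^{(k)}_i - k)/r`. -/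
noncomputable def mayaQuot (r : ℕ) (b : ℕ → ℤ) (k : ℕ) : ℕ → ℤ :=
  fun i => (b (Nat.nth (fun m => b m % (r : ℤ) = (k : ℤ)) i) - (k : ℤ)) / (r : ℤ)

/-! ### The space `U` -/

/-- Maya sequences. -/
def MSeq : Type := {a : ℕ → ℤ // IsMaya a}

/-- Two Maya sequences are equivalent iff they differ by a constant. -/
def mayaSetoid : Setoid MSeq where
  r a b := ∃ c : ℤ, ∀ i : ℕ, a.1 i = b.1 i + c
  iseqv := by
    refine ⟨fun a => ⟨0, fun i => by ring⟩, ?_, ?_⟩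
    · rintro a b ⟨c, h⟩
      exact ⟨-c, fun i => by have := h i; omega⟩
    · rintro a b c ⟨x, h⟩ ⟨y, h'⟩
      exact ⟨x + y, fun i => by have := h i; have := h' i; omega⟩

/-- The set `M` of generalized Maya diagrams. -/
def MayaCl : Type := Quotient mayaSetoid

/-- Permuting the first `n` entries preserves Maya sequences. -/
def permActM {n : ℕ} (σ : Equiv.Perm (Fin n)) (a : MSeq) : MSeq :=
  ⟨permAct σ a.1, by
    obtain ⟨N, hN⟩ := a.2
    refine ⟨max N n, fun i hi => ?_⟩
    have h1 : ¬ i < n := by omega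
    have h2 : ¬ i + 1 < n := by omega
    simp only [permAct, dif_neg h1, dif_neg h2]
    exact hN i (le_trans (le_max_left _ _) hi)⟩

/-- `α + c·ε_i` as a Maya sequence. -/
def addAtM (a : MSeq) (i : ℕ) (c : ℤ) : MSeq :=
  ⟨addAt a.1 i c, by
    obtain ⟨N, hN⟩ := a.2
    refine ⟨max N (i + 1), fun m hm => ?_⟩
    have h1 : m ≠ i := by omega
    have h2 : m + 1 ≠ i := by omega
    simp only [addAt, Function.update_apply, if_neg h1, if_neg h2]
    exact hN m (le_trans (le_max_left _ _) hm)⟩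

/-- The ℚ-vector space with basis `{u_α : α ∈ M}`. -/
abbrev FreeM : Type := MayaCl →₀ ℚ

/-- The vectors `u_{σα} - sgn(σ)·u_α`. -/
def relSet : Set FreeM :=
  {v | ∃ (a : MSeq) (n : ℕ) (σ : Equiv.Perm (Fin n)),
    v = Finsupp.single (Quotient.mk mayaSetoid (permActM σ a)) 1
      - ((Equiv.Perm.sign σ : ℤ) : ℚ) • Finsupp.single (Quotient.mk mayaSetoid a) 1}

/-- The space `U`. -/
abbrev Usp : Type := FreeM ⧸ Submodule.span ℚ relSet

/-- The image of `u_α` in `U`. -/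
noncomputable def uCl (α : MayaCl) : Usp :=
  Submodule.Quotient.mk (Finsupp.single α 1)

/-! ### Skew diagrams and rim hooks -/

/-- The cells of the skew diagram `μ/λ` (0-indexed rows and columns). -/
def cells (f g : ℕ → ℕ) : Set (ℕ × ℕ) := {c | f c.1 ≤ c.2 ∧ c.2 < g c.1}

/-- Two cells are adjacent iff they share an edge. -/
def adjCell (c d : ℕ × ℕ) : Prop :=
  (c.1 = d.1 ∧ (c.2 = d.2 + 1 ∨ d.2 = c.2 + 1)) ∨
  (c.2 = d.2 ∧ (c.1 = d.1 + 1 ∨ d.1 = c.1 + 1))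

/-- A set of cells is edgewise connected. -/
def ConnectedCells (s : Set (ℕ × ℕ)) : Prop :=
  ∀ c ∈ s, ∀ d ∈ s, Relation.ReflTransGen (fun x y => x ∈ s ∧ y ∈ s ∧ adjCell x y) c d

/-- No 2×2 block of cells. -/
def No2x2 (s : Set (ℕ × ℕ)) : Prop :=
  ¬ ∃ i j : ℕ, (i, j) ∈ s ∧ (i + 1, j) ∈ s ∧ (i, j + 1) ∈ s ∧ (i + 1, j + 1) ∈ s

/-- `μ/λ` is an `r`-hook (rim hook of length `r`). -/
def IsRHook (r : ℕ) (f g : ℕ → ℕ) : Prop :=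
  psize g = psize f + r ∧ ConnectedCells (cells f g) ∧ No2x2 (cells f g)

section

open MvPolynomial

/-! ### Algebraic independence of the power sums -/

/-- Chain rule for polynomial substitutions. -/
lemma pderiv_aeval_eq_sum {σ τ : Type*} [Fintype σ] (g : σ → MvPolynomial τ ℚ)
    (F : MvPolynomial σ ℚ) (i : τ) :
    pderiv i (aeval g F) = ∑ j, aeval g (pderiv j F) * pderiv i (g j) := by
  induction F using MvPolynomial.induction_on with
  | C a => simp [algebraMap_eq]
  | add p q hp hq => simp only [map_add, hp, hq, add_mul, Finset.sum_add_distrib]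
  | mul_X p k hp =>
    simp only [map_mul, aeval_X, Derivation.leibniz, smul_eq_mul, hp, map_add, add_mul,
      Finset.sum_add_distrib, pderiv_X, Finset.mul_sum]
    congr 1
    · rw [Finset.sum_eq_single k]
      · simp
      · intro j _ hj
        simp [hj.symm]
      · simp
    · exact Finset.sum_congr rfl fun j _ => by ring

/-- In characteristic zero, a polynomial with vanishing partial derivatives is constant. -/
lemma eq_C_of_pderiv_eq_zero {σ : Type*} {F : MvPolynomial σ ℚ} (h : ∀ i, pderiv i F = 0) :
    F = C (coeff 0 F) := by
  ext m
  rw [coeff_C]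
  split_ifs with hm
  · rw [← hm]
  obtain ⟨i, hi⟩ : ∃ i, m i ≠ 0 := by
    by_contra! hc
    exact hm (by ext i; simp [hc i])
  have h1 : m - Finsupp.single i 1 + Finsupp.single i 1 = m :=
    tsub_add_cancel_of_le (by simpa using Nat.one_le_iff_ne_zero.mpr hi)
  have h2 := coeff_pderiv (i := i) F (m - Finsupp.single i 1)
  rw [h i, coeff_zero, h1] at h2
  rcases mul_eq_zero.mp h2.symm with h3 | h3
  · exact h3
  · exact absurd h3 (by positivity)

/-- The first `n` power sums in `n` variables are algebraically independent. -/
lemma aeval_powerSum_injective (n : ℕ) :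
    Function.Injective (aeval (R := ℚ) fun j : Fin n =>
      ∑ i : Fin n, (X i : MvPolynomial (Fin n) ℚ) ^ ((j : ℕ) + 1)) := by
  set g : Fin n → MvPolynomial (Fin n) ℚ := fun j => ∑ i : Fin n, X i ^ ((j : ℕ) + 1) with hg
  suffices H : ∀ (d : ℕ) (F : MvPolynomial (Fin n) ℚ),
      (∀ m, d ≤ m.degree → coeff m F = 0) → aeval g F = 0 → F = 0 by
    rw [injective_iff_map_eq_zero]
    intro F hF
    refine H (F.totalDegree + 1) F (fun m hm => ?_) hF
    exact coeff_eq_zero_of_totalDegree_lt hm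
  intro d
  induction d with
  | zero =>
    intro F hF _
    ext m
    simp [hF m]
  | succ d ih =>
    intro F hF h0
    have hdg : ∀ i j : Fin n, pderiv i (g j) = (((j : ℕ) + 1 : ℕ) : MvPolynomial (Fin n) ℚ)
        * X i ^ (j : ℕ) := by
      intro i j
      simp only [hg, map_sum, Derivation.leibniz_pow]
      rw [Finset.sum_eq_single i]
      · simp
      · intro k _ hk
        simp [pderiv_X, hk]
      · simp
    have hX : Function.Injective (fun i : Fin n => (X i : MvPolynomial (Fin n) ℚ)) :=
      X_injective
    have hz : (fun j : Fin n => aeval g (pderiv j F) * (((j : ℕ) + 1 : ℕ) :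
        MvPolynomial (Fin n) ℚ)) = 0 := by
      refine Matrix.eq_zero_of_forall_index_sum_mul_pow_eq_zero hX fun i => ?_
      have := pderiv_aeval_eq_sum g F i
      rw [h0, map_zero] at this
      rw [this]
      exact Finset.sum_congr rfl fun j _ => by rw [hdg]; ring
    have hp : ∀ i, pderiv i F = 0 := by
      intro i
      refine ih _ (fun m hm => ?_) ?_
      · rw [coeff_pderiv, hF _ (by simpa using hm), zero_mul]
      · have := congrFun hz i
        simp only [Pi.zero_apply, mul_eq_zero] at this
        rcases this with h | h
        · exact h
        · exact absurd h (Nat.cast_ne_zero.mpr (Nat.succ_ne_zero _))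
    have hC := eq_C_of_pderiv_eq_zero hp
    rw [hC, aeval_C, algebraMap_eq] at h0
    rw [hC, (C_injective _ _ (h0.trans (C_0).symm)), C_0]

/-- An element of `Λ` is zero if its evaluations in all large numbers of variables are. -/
lemma eq_zero_of_ev_eq_zero {F : SymmAlg} {m : ℕ} (h : ∀ n, m ≤ n → ev n F = 0) : F = 0 := by
  obtain ⟨k, hk⟩ := F.vars.exists_nat_subset_range
  set n := max m k
  obtain ⟨G, rfl⟩ := exists_rename_eq_of_vars_subset_range F (Fin.val : Fin n → ℕ)
    Fin.val_injective (fun x hx => by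
      have := Finset.mem_range.mp (hk hx)
      exact ⟨⟨x, lt_of_lt_of_le this (le_max_right _ _)⟩, rfl⟩)
  have h1 := h n (le_max_left _ _)
  rw [ev, aeval_rename] at h1
  rw [(injective_iff_map_eq_zero _).mp (aeval_powerSum_injective n) G h1, map_zero]

lemma eq_of_ev_eq {F G : SymmAlg} {m : ℕ} (h : ∀ n, m ≤ n → ev n F = ev n G) : F = G :=
  sub_eq_zero.mp (eq_zero_of_ev_eq_zero (m := m) fun n hn => by rw [map_sub, h n hn, sub_self])

/-! ### Alternants -/

/-- The alternant `det (x_i^{β_j})`. -/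
noncomputable def alternant {n : ℕ} (β : Fin n → ℕ) : MvPolynomial (Fin n) ℚ :=
  (Matrix.of fun i j => X i ^ β j : Matrix (Fin n) (Fin n) (MvPolynomial (Fin n) ℚ)).det

lemma alternant_eq_sum {n : ℕ} (β : Fin n → ℕ) :
    alternant β = ∑ σ : Equiv.Perm (Fin n), ((Equiv.Perm.sign σ : ℤ) : ℚ) •
      ∏ j, (X (σ j) : MvPolynomial (Fin n) ℚ) ^ β j := by
  rw [alternant, Matrix.det_apply]
  refine Finset.sum_congr rfl fun σ _ => ?_
  rw [Units.smul_def, ← Int.cast_smul_eq_zsmul ℚ]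
  rfl

lemma alternant_comp_perm {n : ℕ} (β : Fin n → ℕ) (σ : Equiv.Perm (Fin n)) :
    alternant (β ∘ σ) = ((Equiv.Perm.sign σ : ℤ) : ℚ) • alternant β := by
  have := Matrix.det_permute' σ
    (Matrix.of fun i j => X i ^ β j : Matrix (Fin n) (Fin n) (MvPolynomial (Fin n) ℚ))
  rw [Int.cast_smul_eq_zsmul, zsmul_eq_mul]
  exact this

lemma alternant_eq_zero {n : ℕ} {β : Fin n → ℕ} {i j : Fin n} (hij : i ≠ j) (h : β i = β j) :
    alternant β = 0 :=
  Matrix.det_zero_of_column_eq hij fun k => by simp [h]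

lemma powerSum_mul_alternant {n : ℕ} (β : Fin n → ℕ) (k : ℕ) :
    (∑ i : Fin n, (X i : MvPolynomial (Fin n) ℚ) ^ k) * alternant β =
      ∑ i, alternant (Function.update β i (β i + k)) := by
  simp only [alternant_eq_sum]
  rw [Finset.sum_comm, Finset.mul_sum]
  refine Finset.sum_congr rfl fun σ _ => ?_
  rw [← Finset.smul_sum, mul_smul_comm, ← Equiv.sum_comp σ, Finset.sum_mul]
  congr 1
  refine Finset.sum_congr rfl fun i _ => ?_
  rw [← Finset.mul_prod_erase _ _ (Finset.mem_univ i),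
    ← Finset.mul_prod_erase _ (fun j => X (σ j) ^ Function.update β i (β i + k) j)
      (Finset.mem_univ i), Function.update_self, pow_add, ← mul_assoc]
  congr 1
  · ring
  · refine Finset.prod_congr rfl fun j hj => ?_
    rw [Function.update_of_ne (Finset.ne_of_mem_erase hj)]

lemma schurMat_emptyPart_det_ne_zero (n : ℕ) : (schurMat emptyPart n).det ≠ 0 := by
  have h : schurMat emptyPart n =
      (Matrix.vandermonde (X : Fin n → MvPolynomial (Fin n) ℚ)).submatrix id Fin.revPerm := by
    ext1 i j
    simp only [schurMat, emptyPart, Matrix.of_apply, Matrix.submatrix_apply, id,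
      Matrix.vandermonde_apply, Fin.revPerm_apply, Fin.val_rev]
    congr 1
    omega
  rw [h, Matrix.det_permute']
  refine mul_ne_zero ?_ (Matrix.det_vandermonde_ne_zero_iff.mpr X_injective)
  rcases Int.units_eq_one_or (Equiv.Perm.sign (Fin.revPerm : Equiv.Perm (Fin n))) with h | h <;>
    simp [h]

/-! ### Maya sequences with a given tail -/

/-- From position `n` on, the entries of `a` are consecutive, and all earlier entries are
larger. -/
def TailAt (a : ℕ → ℤ) (n : ℕ) : Prop := (∀ i : ℕ, n ≤ i → a i = a n + n - i) ∧ ∀ j < n, a n < a j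

/-- The exponents of the alternant in `n` variables attached to `a`. -/
def betaAt (a : ℕ → ℤ) (n : ℕ) : Fin n → ℕ := fun j => (a j - a n - 1).toNat

lemma TailAt.isMaya {a : ℕ → ℤ} {n : ℕ} (h : TailAt a n) : IsMaya a :=
  ⟨n, fun i hi => by
    have h1 := h.1 i hi
    have h2 := h.1 (i + 1) (by omega)
    push_cast at h2
    omega⟩

lemma IsMaya.exists_tailAt {a : ℕ → ℤ} (h : IsMaya a) : ∃ N, ∀ n, N ≤ n → TailAt a n := by
  obtain ⟨N, hN⟩ := h
  have h1 : ∀ i : ℕ, N ≤ i → a i = a N + N - i := by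
    intro i hi
    induction i, hi using Nat.le_induction with
    | base => omega
    | succ i hi ih => rw [hN i hi, ih]; push_cast; ring
  obtain ⟨b, hb⟩ : ∃ b, ∀ j < N, b ≤ a j := by
    obtain ⟨b, hb⟩ := ((Finset.range N).image a).bddBelow
    exact ⟨b, fun j hj => hb (by simpa using ⟨j, hj, rfl⟩)⟩
  refine ⟨N + (a N - b).toNat + 1, fun n hn => ⟨fun i hi => ?_, fun j hj => ?_⟩⟩
  · rw [h1 i (by omega), h1 n (by omega)]; ring
  · rw [h1 n (by omega)]
    by_cases hjN : j < N
    · have := hb j hjN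
      omega
    · rw [h1 j (by omega)]
      omega

lemma TailAt.eq_of_le {a : ℕ → ℤ} {n i j : ℕ} (h : TailAt a n) (hj : n ≤ j) (hij : a i = a j) :
    i = j := by
  have h1 := h.1 j hj
  by_cases hi : i < n
  · have := h.2 i hi
    omega
  · have := h.1 i (by omega)
    omega

lemma TailAt.permAct {a : ℕ → ℤ} {n : ℕ} (h : TailAt a n) (σ : Equiv.Perm (Fin n)) :
    TailAt (permAct σ a) n := by
  refine ⟨fun i hi => ?_, fun j hj => ?_⟩
  · simp [RSF.permAct, not_lt.mpr hi, h.1 i hi]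
  · simp only [RSF.permAct, lt_irrefl, dif_neg, not_false_eq_true, dif_pos hj]
    exact h.2 _ (Fin.is_lt _)

lemma TailAt.addAt {a : ℕ → ℤ} {n i k : ℕ} (h : TailAt a n) (hi : i < n) :
    TailAt (addAt a i k) n := by
  refine ⟨fun j hj => ?_, fun j hj => ?_⟩
  · simp only [RSF.addAt]
    rw [Function.update_of_ne (by omega), Function.update_of_ne (by omega), h.1 j hj]
  · have := h.2 j hj
    simp only [RSF.addAt]
    rw [Function.update_of_ne (show n ≠ i by omega), Function.update_apply]
    split_ifs with hji
    · subst hji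
      omega
    · exact this

lemma betaAt_permAct {a : ℕ → ℤ} {n : ℕ} (σ : Equiv.Perm (Fin n)) :
    betaAt (permAct σ a) n = betaAt a n ∘ ⇑(σ⁻¹) := by
  ext j
  simp [betaAt, permAct]

lemma betaAt_addAt {a : ℕ → ℤ} {n k : ℕ} (h : TailAt a n) (i : Fin n) :
    betaAt (addAt a i k) n = Function.update (betaAt a n) i (betaAt a n i + k) := by
  ext j
  have h1 := h.2 i i.2
  have h2 := i.2
  simp only [betaAt, addAt, Function.update_apply, Fin.val_inj]
  rw [if_neg (show n ≠ (i : ℕ) by omega)]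
  split_ifs with hji
  · omega
  · rfl

/-- Increasing by `k` an entry far in the tail creates a repetition. -/
lemma TailAt.addAt_repeats {a : ℕ → ℤ} {n i k : ℕ} (h : TailAt a n) (hk : k ≠ 0)
    (hi : n + k ≤ i) :
    ∃ j j' : ℕ, j ≠ j' ∧ RSF.addAt a i k j = RSF.addAt a i k j' := by
  refine ⟨i, i - k, by omega, ?_⟩
  have h1 := h.1 i (by omega)
  have h2 := h.1 (i - k) (by omega)
  simp only [RSF.addAt, Function.update_self]
  rw [Function.update_of_ne (by omega)]
  omega

/-- Extending a permutation to more letters changes neither its sign nor its action. -/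
lemma exists_perm_permAct_eq {m n : ℕ} (hmn : m ≤ n) (σ : Equiv.Perm (Fin m)) :
    ∃ τ : Equiv.Perm (Fin n), Equiv.Perm.sign τ = Equiv.Perm.sign σ ∧
      ∀ a : ℕ → ℤ, permAct τ a = permAct σ a := by
  refine ⟨σ.viaFintypeEmbedding (Fin.castLEEmb hmn), Equiv.Perm.viaFintypeEmbedding_sign _ _, ?_⟩
  intro a
  funext i
  have hinv : (σ.viaFintypeEmbedding (Fin.castLEEmb hmn))⁻¹ =
      (σ⁻¹).viaFintypeEmbedding (Fin.castLEEmb hmn) := rfl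
  simp only [permAct, hinv]
  by_cases hi : i < m
  · rw [dif_pos hi, dif_pos (by omega)]
    have := Equiv.Perm.viaFintypeEmbedding_apply_image (σ⁻¹) (Fin.castLEEmb hmn) ⟨i, hi⟩
    exact congrArg (fun x : Fin n => a x) this
  · rw [dif_neg hi]
    split_ifs with hin
    · rw [Equiv.Perm.viaFintypeEmbedding_apply_notMem_range]
      rintro ⟨x, hx⟩
      have := congrArg Fin.val hx
      simp at this
      omega
    · rfl

/-! ### Schur functions of Maya sequences as quotients of alternants -/

/-- The family `SM` is given by quotients of alternants in all large numbers of variables. -/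
def IsAlternantFamily (SM : (ℕ → ℤ) → SymmAlg) : Prop :=
  ∀ (a : ℕ → ℤ) (n : ℕ), TailAt a n →
    ev n (SM a) * (schurMat emptyPart n).det = alternant (betaAt a n)

lemma IsMayaSchur.isAlternantFamily {S : (ℕ → ℕ) → SymmAlg} (hS : IsSchurFamily S)
    {SM : (ℕ → ℤ) → SymmAlg} (hSM : IsMayaSchur S SM) : IsAlternantFamily SM := by
  intro a n ha
  by_cases hrep : ∃ i j : ℕ, i ≠ j ∧ a i = a j
  · rw [hSM.1 a ha.isMaya hrep, map_zero, zero_mul]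
    obtain ⟨i, j, hij, h⟩ := hrep
    have hj : j < n := by
      by_contra hj
      exact hij (ha.eq_of_le (by omega) h)
    have hi : i < n := by
      by_contra hi
      exact hij (ha.eq_of_le (by omega) h.symm).symm
    refine (alternant_eq_zero (i := ⟨i, hi⟩) (j := ⟨j, hj⟩) (by simpa using hij) ?_).symm
    simp [betaAt, h]
  push Not at hrep
  set τ : Equiv.Perm (Fin n) := Tuple.sort fun j : Fin n => -a j
  set b := permAct τ⁻¹ a with hb
  have hbn : TailAt b n := ha.permAct _
  have hbv : ∀ i : Fin n, b i = a (τ i) := fun i => by simp [hb, permAct]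
  have hban : b n = a n := by simp [hb, permAct]
  have hdec : StrictDec b := by
    intro i j hij
    by_cases hj : j < n
    · have h1 : -a (τ ⟨i, by omega⟩) ≤ -a (τ ⟨j, hj⟩) :=
        Tuple.monotone_sort (fun j : Fin n => -a j) (Fin.mk_le_mk.mpr hij.le)
      have h2 : a (τ ⟨i, by omega⟩) ≠ a (τ ⟨j, hj⟩) := by
        refine hrep _ _ fun h => ?_
        have := τ.injective (Fin.ext h)
        simp only [Fin.mk.injEq] at this
        omega
      have h3 := hbv ⟨i, by omega⟩
      have h4 := hbv ⟨j, hj⟩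
      simp only at h3 h4
      omega
    · have h1 := hbn.1 j (by omega)
      by_cases hi : i < n
      · have := hbn.2 i hi
        omega
      · have := hbn.1 i (by omega)
        omega
  have hanti : ∀ i j : ℕ, i ≤ j → b j + j ≤ b i + i := by
    intro i j hij
    induction j, hij using Nat.le_induction with
    | base => exact le_rfl
    | succ j _ ih =>
      have := hdec j (j + 1) (by omega)
      push_cast
      omega
  have hge : ∀ i, a n + n ≤ b i + i := by
    intro i
    by_cases hi : i ≤ n
    · have := hanti i n hi
      omega
    · have := hbn.1 i (by omega)
      omega
  set f : ℕ → ℕ := fun i => (b i + i - a n - n).toNat with hf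
  have hfz : ∀ i, n ≤ i → f i = 0 := fun i hi => by
    have := hbn.1 i hi
    simp only [hf]
    omega
  have hpart : IsPartition f := by
    refine ⟨fun i j hij => ?_, n, hfz⟩
    have := hanti i j hij
    simp only [hf]
    omega
  have hcorr : MayaCorresponds b f := by
    refine ⟨n, fun m hm j _ => ?_⟩
    have h1 := hbn.1 m hm
    have h2 := hge j
    simp only [hf]
    omega
  have hplen : plen f ≤ n := Nat.sInf_le hfz
  have hmat : (schurMat f n).det = alternant (betaAt a n ∘ τ) := by
    rw [alternant]
    congr 1
    ext1 i j
    simp only [schurMat, Matrix.of_apply, betaAt, Function.comp_apply]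
    congr 1
    have h1 := hbv j
    have h2 := hge j
    have h3 := ha.2 (τ j) (τ j).2
    have h4 := j.2
    simp only [hf]
    omega
  rw [hSM.2 a ha.isMaya n τ⁻¹ f hdec hcorr, map_smul, smul_mul_assoc, hS f hpart n hplen, hmat,
    alternant_comp_perm, smul_smul, Equiv.Perm.sign_inv, ← Int.cast_mul, Int.units_coe_mul_self,
    Int.cast_one, one_smul]

lemma eq_of_ev_mul_eq {F G : SymmAlg} {m : ℕ}
    (h : ∀ n, m ≤ n → ev n F * (schurMat emptyPart n).det =
      ev n G * (schurMat emptyPart n).det) : F = G :=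
  eq_of_ev_eq fun n hn => mul_right_cancel₀ (schurMat_emptyPart_det_ne_zero n) (h n hn)

namespace IsAlternantFamily

variable {SM : (ℕ → ℤ) → SymmAlg}

lemma eq_of_shift (h : IsAlternantFamily SM) {a b : ℕ → ℤ} (ha : IsMaya a) (hb : IsMaya b)
    {c : ℤ} (hab : ∀ i, a i = b i + c) : SM a = SM b := by
  obtain ⟨N, hN⟩ := ha.exists_tailAt
  obtain ⟨N', hN'⟩ := hb.exists_tailAt
  refine eq_of_ev_mul_eq (m := max N N') fun n hn => ?_
  rw [h a n (hN n (by omega)), h b n (hN' n (by omega))]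
  congr 1
  ext j
  simp [betaAt, hab]

lemma apply_permAct (h : IsAlternantFamily SM) {a : ℕ → ℤ} (ha : IsMaya a) {m : ℕ}
    (σ : Equiv.Perm (Fin m)) : SM (permAct σ a) = ((Equiv.Perm.sign σ : ℤ) : ℚ) • SM a := by
  obtain ⟨N, hN⟩ := ha.exists_tailAt
  refine eq_of_ev_mul_eq (m := max N m) fun n hn => ?_
  obtain ⟨τ, hτ, hτa⟩ := exists_perm_permAct_eq (show m ≤ n by omega) σ
  have han := hN n (by omega)
  rw [← hτa, ← hτ, h _ n (han.permAct τ), map_smul, smul_mul_assoc, h a n han, betaAt_permAct,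
    alternant_comp_perm, Equiv.Perm.sign_inv]

lemma eq_zero_of_repeat (h : IsAlternantFamily SM) {a : ℕ → ℤ} (ha : IsMaya a)
    (hrep : ∃ i j : ℕ, i ≠ j ∧ a i = a j) : SM a = 0 := by
  obtain ⟨N, hN⟩ := ha.exists_tailAt
  obtain ⟨i, j, hij, haij⟩ := hrep
  refine eq_of_ev_mul_eq (m := max N (max (i + 1) (j + 1))) fun n hn => ?_
  rw [h a n (hN n (by omega)), map_zero, zero_mul]
  refine alternant_eq_zero (i := ⟨i, by omega⟩) (j := ⟨j, by omega⟩) (by simpa using hij) ?_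
  simp [betaAt, haij]

lemma apply_neg (h : IsAlternantFamily SM) : SM (fun i => -(i : ℤ)) = 1 := by
  refine eq_of_ev_mul_eq (m := 0) fun n _ => ?_
  rw [h _ n ⟨fun i _ => by ring, fun j hj => by omega⟩, map_one, one_mul, alternant]
  congr 1
  ext1 i j
  simp only [betaAt, schurMat, emptyPart, Matrix.of_apply]
  congr 1
  omega

/-- Multiplication by a power sum. -/
lemma X_mul (h : IsAlternantFamily SM) {a : ℕ → ℤ} (ha : IsMaya a) (m : ℕ) :
    ∃ N, (∀ i, N ≤ i → ∃ j j' : ℕ, j ≠ j' ∧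
        addAt a i ((m + 1 : ℕ) : ℤ) j = addAt a i ((m + 1 : ℕ) : ℤ) j') ∧
      X m * SM a = ∑ i ∈ Finset.range N, SM (addAt a i ((m + 1 : ℕ) : ℤ)) := by
  obtain ⟨N, hN⟩ := ha.exists_tailAt
  have hrep := fun i (hi : N + (m + 1) ≤ i) =>
    (hN N le_rfl).addAt_repeats (Nat.succ_ne_zero m) hi
  refine ⟨N + (m + 1), hrep, eq_of_ev_mul_eq (m := N + (m + 1)) fun n hn => ?_⟩
  have han := hN n (by omega)
  have hsum : ∑ i ∈ Finset.range (N + (m + 1)), SM (addAt a i ((m + 1 : ℕ) : ℤ)) =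
      ∑ i ∈ Finset.range n, SM (addAt a i ((m + 1 : ℕ) : ℤ)) := by
    refine Finset.sum_subset (Finset.range_mono hn) fun i _ hi => ?_
    exact h.eq_zero_of_repeat (addAtM ⟨a, ha⟩ i _).2
      (hrep i (by simpa using hi))
  have hX : ev n (X m) = ∑ i : Fin n, (X i : MvPolynomial (Fin n) ℚ) ^ (m + 1) := by
    simp only [ev, aeval_X]
  rw [hsum, map_mul, mul_assoc, h a n han, hX, powerSum_mul_alternant, map_sum, Finset.sum_mul,
    Finset.sum_range]
  refine Finset.sum_congr rfl fun i _ => ?_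
  rw [h _ n (han.addAt i.2), betaAt_addAt han]

end IsAlternantFamily

/-! ### The isomorphism `U ≃ Λ` -/

/-- The basis vector of `FreeM` given by a Maya sequence. -/
noncomputable def freeOf (a : MSeq) : FreeM :=
  Finsupp.single (Quotient.mk mayaSetoid a : MayaCl) 1

/-- The class `u_a` of a Maya sequence. -/
noncomputable def uOf (a : MSeq) : Usp := uCl (Quotient.mk mayaSetoid a)

lemma uOf_eq_mk (a : MSeq) : uOf a = Submodule.Quotient.mk (freeOf a) := rfl

lemma uOf_permActM (a : MSeq) {n : ℕ} (σ : Equiv.Perm (Fin n)) :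
    uOf (permActM σ a) = ((Equiv.Perm.sign σ : ℤ) : ℚ) • uOf a := by
  rw [uOf_eq_mk, uOf_eq_mk, ← Submodule.Quotient.mk_smul, Submodule.Quotient.eq]
  exact Submodule.subset_span ⟨a, n, σ, rfl⟩

lemma uOf_eq_zero_of_repeat (a : MSeq) (hrep : ∃ i j : ℕ, i ≠ j ∧ a.1 i = a.1 j) :
    uOf a = 0 := by
  obtain ⟨i, j, hij, haij⟩ := hrep
  set n := max i j + 1
  set σ : Equiv.Perm (Fin n) := Equiv.swap ⟨i, by omega⟩ ⟨j, by omega⟩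
  have hσ : permActM σ a = a := by
    refine Subtype.ext (funext fun k => ?_)
    simp only [permActM, permAct, σ, Equiv.swap_inv]
    split_ifs with hk
    · rw [Equiv.swap_apply_def]
      split_ifs with h1 h2
      · simp only [Fin.mk.injEq] at h1
        rw [h1, haij]
      · simp only [Fin.mk.injEq] at h2
        rw [h2, haij]
      · rfl
    · rfl
  have h := uOf_permActM a σ
  rw [hσ, Equiv.Perm.sign_swap (by simpa using hij)] at h
  simp only [Units.val_neg, Units.val_one, Int.cast_neg, Int.cast_one, neg_smul, one_smul] at h
  have h2 : (2 : ℚ) • uOf a = 0 := by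
    rw [two_smul]
    nth_rewrite 1 [h]
    exact neg_add_cancel _
  exact (smul_eq_zero.mp h2).resolve_left two_ne_zero

lemma uOf_eq_of_shift {a b : MSeq} {c : ℤ} (h : ∀ i, a.1 i = b.1 i + c) : uOf a = uOf b :=
  congrArg uCl (Quotient.sound ⟨c, h⟩)

/-- The Maya sequence `β_0, …, β_{n-1}, -1, -2, …`. -/
def extSeq {n : ℕ} (β : Fin n → ℕ) : MSeq :=
  ⟨fun i => if h : i < n then (β ⟨i, h⟩ : ℤ) else n - 1 - i, n, fun i hi => by
    simp only [dif_neg (show ¬ i < n by omega), dif_neg (show ¬ i + 1 < n by omega)]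
    push_cast
    ring⟩

lemma uOf_extSeq_betaAt {a : MSeq} {n : ℕ} (h : TailAt a.1 n) :
    uOf (extSeq (betaAt a.1 n)) = uOf a := by
  refine uOf_eq_of_shift (c := -a.1 n - 1) fun i => ?_
  simp only [extSeq, betaAt]
  split_ifs with hi
  · have := h.2 i hi
    omega
  · have := h.1 i (by omega)
    omega

lemma extSeq_comp_inv {n : ℕ} (β : Fin n → ℕ) (σ : Equiv.Perm (Fin n)) :
    extSeq (β ∘ ⇑(σ⁻¹)) = permActM σ (extSeq β) := by
  refine Subtype.ext (funext fun k => ?_)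
  simp only [extSeq, permActM, permAct]
  by_cases hk : k < n <;> simp [hk]

/-- The linear map sending the monomial `x^β` to the class of `β_0, …, β_{n-1}, -1, -2, …`. -/
noncomputable def monomialToU (n : ℕ) : MvPolynomial (Fin n) ℚ →ₗ[ℚ] Usp :=
  (basisMonomials (Fin n) ℚ).constr ℚ fun s => uOf (extSeq s)

lemma monomialToU_prod {n : ℕ} (β : Fin n → ℕ) :
    monomialToU n (∏ j, X j ^ β j) = uOf (extSeq β) := by
  have h : (∏ j, X j ^ β j : MvPolynomial (Fin n) ℚ) =
      basisMonomials (Fin n) ℚ (Finsupp.equivFunOnFinite.symm β) := by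
    rw [coe_basisMonomials]
    simp [monomial_eq, Finsupp.prod_fintype]
  rw [h, monomialToU, Module.Basis.constr_basis]
  rfl

lemma monomialToU_alternant {n : ℕ} (β : Fin n → ℕ) :
    monomialToU n (alternant β) = (n.factorial : ℚ) • uOf (extSeq β) := by
  rw [alternant_eq_sum, map_sum]
  have h : ∀ σ : Equiv.Perm (Fin n), monomialToU n (((Equiv.Perm.sign σ : ℤ) : ℚ) •
      ∏ j, (X (σ j) : MvPolynomial (Fin n) ℚ) ^ β j) = uOf (extSeq β) := by
    intro σ
    have h1 : ∏ j, (X (σ j) : MvPolynomial (Fin n) ℚ) ^ β j = ∏ j, X j ^ (β ∘ ⇑(σ⁻¹)) j := by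
      rw [← Equiv.prod_comp σ (fun j => (X j : MvPolynomial (Fin n) ℚ) ^ (β ∘ ⇑(σ⁻¹)) j)]
      simp
    rw [h1, map_smul, monomialToU_prod, extSeq_comp_inv, uOf_permActM, smul_smul, ← Int.cast_mul,
      Int.units_coe_mul_self, Int.cast_one, one_smul]
  simp only [h, Finset.sum_const, Finset.card_univ, Fintype.card_perm, Fintype.card_fin]
  rw [Nat.cast_smul_eq_nsmul]

lemma Usp_induction {P : Usp → Prop} (h0 : P 0) (hadd : ∀ x y, P x → P y → P (x + y))
    (hsmul : ∀ (c : ℚ) a, P (c • uOf a)) (x : Usp) : P x := by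
  obtain ⟨v, rfl⟩ := Submodule.Quotient.mk_surjective _ x
  induction v using Finsupp.induction_linear with
  | zero => exact h0
  | add v w hv hw => exact hadd _ _ hv hw
  | single α c =>
    obtain ⟨a, rfl⟩ := Quotient.exists_rep α
    have hc : c • freeOf a = Finsupp.single (Quotient.mk mayaSetoid a : MayaCl) c :=
      (Finsupp.smul_single c _ _).trans (congrArg _ (mul_one c))
    have := hsmul c a
    rwa [uOf_eq_mk, ← Submodule.Quotient.mk_smul, hc] at this

namespace IsAlternantFamily

variable {SM : (ℕ → ℤ) → SymmAlg}

lemma exists_linearMap (h : IsAlternantFamily SM) :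
    ∃ Φ : Usp →ₗ[ℚ] SymmAlg, ∀ a, Φ (uOf a) = SM a.1 := by
  let φ : FreeM →ₗ[ℚ] SymmAlg := Finsupp.linearCombination ℚ
    (Quotient.lift (fun a : MSeq => SM a.1) fun a b ⟨_, hc⟩ => h.eq_of_shift a.2 b.2 hc)
  have hφ : ∀ a : MSeq, φ (freeOf a) = SM a.1 := fun a =>
    (Finsupp.linearCombination_single ℚ _ _).trans (one_smul _ _)
  refine ⟨Submodule.liftQ _ φ (Submodule.span_le.mpr ?_), fun a => ?_⟩
  · rintro _ ⟨a, n, σ, rfl⟩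
    change φ (freeOf (permActM σ a) - ((Equiv.Perm.sign σ : ℤ) : ℚ) • freeOf a) = 0
    rw [map_sub, map_smul, hφ, hφ]
    exact sub_eq_zero.mpr (h.apply_permAct a.2 σ)
  · rw [uOf_eq_mk, Submodule.liftQ_apply, hφ]

variable {Φ : Usp →ₗ[ℚ] SymmAlg}

lemma injective (h : IsAlternantFamily SM) (hΦ : ∀ a, Φ (uOf a) = SM a.1) :
    Function.Injective Φ := by
  have key : ∀ x : Usp, ∃ N, ∀ n, N ≤ n →
      monomialToU n (ev n (Φ x) * (schurMat emptyPart n).det) = (n.factorial : ℚ) • x := by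
    refine Usp_induction ⟨0, fun n _ => by simp⟩ ?_ fun c a => ?_
    · rintro x y ⟨N, hN⟩ ⟨N', hN'⟩
      refine ⟨max N N', fun n hn => ?_⟩
      rw [map_add, map_add, add_mul, map_add, hN n (by omega), hN' n (by omega), smul_add]
    · obtain ⟨N, hN⟩ := a.2.exists_tailAt
      refine ⟨N, fun n hn => ?_⟩
      rw [map_smul, map_smul, smul_mul_assoc, map_smul, hΦ, h _ n (hN n hn),
        monomialToU_alternant, uOf_extSeq_betaAt (hN n hn), smul_comm]
  rw [injective_iff_map_eq_zero]
  intro x hx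
  obtain ⟨N, hN⟩ := key x
  have := hN N le_rfl
  rw [hx, map_zero, zero_mul, map_zero] at this
  exact (smul_eq_zero.mp this.symm).resolve_left (by positivity)

lemma map_finsum (h : IsAlternantFamily SM) (hΦ : ∀ a, Φ (uOf a) = SM a.1) (a : MSeq) (m : ℕ) :
    Φ (∑ᶠ i : ℕ, uOf (addAtM a i ((m + 1 : ℕ) : ℤ))) = X m * SM a.1 := by
  obtain ⟨N, hN, hX⟩ := h.X_mul a.2 m
  rw [finsum_eq_sum_of_support_subset (s := Finset.range N), map_sum, hX]
  · exact Finset.sum_congr rfl fun i _ => hΦ _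
  · intro i hi
    rw [Finset.coe_range, Set.mem_Iio]
    by_contra hc
    exact hi (uOf_eq_zero_of_repeat _ (hN i (by omega)))

lemma surjective (h : IsAlternantFamily SM) (hΦ : ∀ a, Φ (uOf a) = SM a.1) :
    Function.Surjective Φ := by
  intro F
  induction F using MvPolynomial.induction_on with
  | C c =>
    have hM : IsMaya fun i => -(i : ℤ) := ⟨0, fun i _ => by push_cast; ring⟩
    let a : MSeq := ⟨_, hM⟩
    refine ⟨c • uOf a, ?_⟩
    rw [map_smul, hΦ, show SM a.1 = 1 from h.apply_neg, smul_eq_C_mul, mul_one]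
  | add p q hp hq =>
    obtain ⟨x, rfl⟩ := hp
    obtain ⟨y, rfl⟩ := hq
    exact ⟨x + y, map_add _ _ _⟩
  | mul_X p m hp =>
    obtain ⟨x, rfl⟩ := hp
    change Φ x * X m ∈ LinearMap.range Φ
    revert x
    refine Usp_induction ?_ (fun x y hx hy => ?_) fun c a => ?_
    · simp
    · rw [map_add, add_mul]
      exact add_mem hx hy
    · rw [map_smul, smul_mul_assoc, hΦ, mul_comm, ← h.map_finsum hΦ]
      exact Submodule.smul_mem _ _ ⟨_, rfl⟩

end IsAlternantFamily

/-! ### The reduction homomorphism -/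

/-- The section `t_j ↦ p_j / j` of `rho r`. -/
noncomputable def rhoSection (r : ℕ) : PR r →ₐ[ℚ] SymmAlg :=
  aeval fun j => ((j.1 : ℚ)⁻¹) • X (j.1 - 1)

lemma rho_X_of_dvd {r m : ℕ} (h : r ∣ m + 1) : rho r (X m) = 0 := by
  simp [rho, h]

lemma rho_X_of_not_dvd {r m : ℕ} (h : ¬ r ∣ m + 1) :
    rho r (X m) = ((m + 1 : ℕ) : ℚ) • X ⟨m + 1, Nat.succ_pos m, h⟩ := by
  simp only [rho, aeval_X, dif_neg h]

lemma rho_rhoSection (r : ℕ) (F : PR r) : rho r (rhoSection r F) = F := by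
  suffices H : (rho r).comp (rhoSection r) = AlgHom.id ℚ (PR r) from DFunLike.congr_fun H F
  refine algHom_ext ?_
  rintro ⟨j, hj, hrj⟩
  obtain ⟨m, rfl⟩ := Nat.exists_eq_succ_of_ne_zero hj.ne'
  simp only [AlgHom.comp_apply, rhoSection, aeval_X, map_smul, AlgHom.id_apply]
  rw [Nat.succ_sub_one, rho_X_of_not_dvd hrj, smul_smul, inv_mul_cancel₀ (by positivity), one_smul]

/-- The kernel of `rho r` is generated by the power sums `p_j` with `r ∣ j`. -/
lemma mem_span_of_rho_eq_zero {r : ℕ} {F : SymmAlg} (hF : rho r F = 0) :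
    F ∈ Ideal.span {p : SymmAlg | ∃ m : ℕ, r ∣ m + 1 ∧ p = X m} := by
  set I := Ideal.span {p : SymmAlg | ∃ m : ℕ, r ∣ m + 1 ∧ p = X m}
  have H : ((Ideal.Quotient.mkₐ ℚ I).comp (rhoSection r)).comp (rho r) =
      Ideal.Quotient.mkₐ ℚ I := by
    refine algHom_ext fun m => ?_
    simp only [AlgHom.comp_apply]
    by_cases hm : r ∣ m + 1
    · have hmI : X m ∈ I := Ideal.subset_span ⟨m, hm, rfl⟩
      rw [rho_X_of_dvd hm, map_zero, map_zero]
      exact (Ideal.Quotient.eq_zero_iff_mem.mpr hmI).symm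
    · rw [rho_X_of_not_dvd hm, map_smul, rhoSection, aeval_X, smul_smul,
        mul_inv_cancel₀ (by positivity), one_smul, Nat.add_sub_cancel]
  have := DFunLike.congr_fun H F
  simp only [AlgHom.comp_apply, hF, map_zero] at this
  exact Ideal.Quotient.eq_zero_iff_mem.mp this.symm

end

/-- **Lemma 3.2 (3).** Let `U_r` be the quotient of `U` by the span of all the sums
`Σ_{i≥1} u_{α+jrε_i}` (`α ∈ M`, `j ≥ 1`).  Then `u_α ↦ S^(r)_α(t)` induces a well-defined
ℚ-linear isomorphism `U_r ≃ P^(r)`. -/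
theorem Ur_iso_PR
    (r : ℕ) (hr : 2 ≤ r)
    (S : (ℕ → ℕ) → SymmAlg) (hS : IsSchurFamily S)
    (SM : (ℕ → ℤ) → SymmAlg) (hSM : IsMayaSchur S SM) :
    ∃ T : (Usp ⧸ Submodule.span ℚ
        {v : Usp | ∃ (a : MSeq) (j : ℕ), 1 ≤ j ∧
          v = ∑ᶠ i : ℕ, uCl (Quotient.mk mayaSetoid (addAtM a i ((j * r : ℕ) : ℤ)))})
        ≃ₗ[ℚ] PR r,
      ∀ a : MSeq,
        T (Submodule.Quotient.mk (uCl (Quotient.mk mayaSetoid a))) = rho r (SM a.1) := by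
  have h := hSM.isAlternantFamily hS
  obtain ⟨Φ, hΦ⟩ := h.exists_linearMap
  set N : Submodule ℚ Usp := Submodule.span ℚ
    {v : Usp | ∃ (a : MSeq) (j : ℕ), 1 ≤ j ∧
      v = ∑ᶠ i : ℕ, uCl (Quotient.mk mayaSetoid (addAtM a i ((j * r : ℕ) : ℤ)))}
  have hΨ : Function.Surjective ((rho r).toLinearMap ∘ₗ Φ) := fun F => by
    obtain ⟨x, hx⟩ := h.surjective hΦ (rhoSection r F)
    exact ⟨x, by simp [hx, rho_rhoSection]⟩
  have hker : N = LinearMap.ker ((rho r).toLinearMap ∘ₗ Φ) := by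
    apply le_antisymm
    · refine Submodule.span_le.mpr ?_
      rintro _ ⟨a, j, hj, rfl⟩
      obtain ⟨m, hm⟩ := Nat.exists_eq_succ_of_ne_zero (show j * r ≠ 0 by positivity)
      rw [hm]
      have := h.map_finsum hΦ a m
      simp only [uOf] at this
      rw [SetLike.mem_coe, LinearMap.mem_ker, LinearMap.comp_apply, this, AlgHom.toLinearMap_apply,
        map_mul, rho_X_of_dvd ⟨j, by rw [mul_comm, hm]⟩, zero_mul]
    · intro x hx
      have hmul : ∀ m : ℕ, r ∣ m + 1 → ∀ y : Usp, Φ y * MvPolynomial.X m ∈ N.map Φ := by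
        rintro m ⟨j, hj⟩
        refine Usp_induction (by simp) (fun y z hy hz => ?_) fun c a => ?_
        · rw [map_add, add_mul]
          exact add_mem hy hz
        · rw [map_smul, smul_mul_assoc, hΦ, mul_comm, ← h.map_finsum hΦ, hj, mul_comm r j]
          refine Submodule.smul_mem _ _ (Submodule.mem_map_of_mem (Submodule.subset_span
            ⟨a, j, Nat.one_le_iff_ne_zero.mpr ?_, rfl⟩))
          rintro rfl
          omega
      have hspan : ∀ F ∈ Ideal.span {p : SymmAlg | ∃ m : ℕ, r ∣ m + 1 ∧ p = MvPolynomial.X m},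
          F ∈ N.map Φ := by
        intro F hF
        induction hF using Submodule.closure_induction with
        | zero => exact zero_mem _
        | add p q _ _ hp hq => exact add_mem hp hq
        | smul_mem g p hp =>
          obtain ⟨m, hm, rfl⟩ := hp
          obtain ⟨y, rfl⟩ := h.surjective hΦ g
          exact hmul m hm y
      obtain ⟨y, hy, hxy⟩ := hspan _ (mem_span_of_rho_eq_zero hx)
      exact h.injective hΦ hxy ▸ hy
  refine ⟨(Submodule.quotEquivOfEq _ _ hker).trans
    (LinearMap.quotKerEquivOfSurjective _ hΨ), fun a => ?_⟩
  rw [LinearEquiv.trans_apply, Submodule.quotEquivOfEq_mk,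
    LinearMap.quotKerEquivOfSurjective_apply_mk, LinearMap.comp_apply]
  exact congrArg (rho r) (hΦ a)

end RSF
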